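/- Let τ > 0 and let F : ℝ × 𝒞 → ℝᵐ be weakly nonlinear with constants K > 0, A ≥ 0, and assume K·τ·e < 1. For (t, z) ∈ ℝ × ℝᵐ let ȳ(t, z) denote the unique special solution of the DDE y′(t) = F(t, y_t) with ȳ(t,z)(t) = z, and define F̃ : ℝ × ℝᵐ → ℝᵐ by F̃(t, z) = F(t, [ȳ(t,z)]_t), where [ȳ(t,z)]_t ∈ 𝒞 is the function s ↦ ȳ(t,z)(t+s) for s ∈ [−τ,0]. Then: (i) F̃ is continuous and globally Lipschitz continuous in its second variable with Lipschitz constant |λ₁|, where λ₁ ∈ (−1/τ, 0) is the unique solution of λ = −K·e^{−λτ}, and |λ₁| < K·e; and (ii) for every (t₀, y₀) ∈ ℝ × ℝᵐ, the initial value problem z′(t) = F̃(t, z(t)), z(t₀) = y₀ is uniquely solved by the special solution ȳ(t₀, y₀). -/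

import Mathlib

open Set

noncomputable section

/-- The history space `𝒞 = C([-τ,0], ℝᵐ)` with the sup norm; `ℝᵐ` carries the max norm. -/
abbrev Hist (τ : ℝ) (m : ℕ) : Type := C(Set.Icc (-τ) (0:ℝ), Fin m → ℝ)

/-- The constant history function `c_v ∈ 𝒞`. -/
def histConst {m : ℕ} (τ : ℝ) (v : Fin m → ℝ) : Hist τ m := ContinuousMap.const _ v

-- The history segment `y_t ∈ 𝒞`, defined by `y_t(s) = y(t+s)` for `s ∈ [-τ,0]`
-- (junk value if `y` is not continuous).
open Classical in
def seg {m : ℕ} (τ : ℝ) (y : ℝ → Fin m → ℝ) (t : ℝ) : Hist τ m :=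
  if hy : Continuous y then
    ⟨fun s => y (t + s.1), hy.comp (continuous_const.add continuous_subtype_val)⟩
  else 0

/-- Operator norm of a matrix, induced by the maximum norms. -/
def opNormMax {m n : ℕ} (W : Matrix (Fin m) (Fin n) ℝ) : ℝ :=
  ‖LinearMap.toContinuousLinearMap W.mulVecLin‖

/-- `y` is a (continuous) solution on `[0,T]` of the DDE `y'(t) = F(t, y_t)` with constant
initial data `y ≡ v` on `[-τ,0]` (one-sided derivatives at the endpoints of `[0,T]`). -/
def IsSolOn {m : ℕ} (τ T : ℝ) (F : ℝ → Hist τ m → Fin m → ℝ)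
    (v : Fin m → ℝ) (y : ℝ → Fin m → ℝ) : Prop :=
  Continuous y ∧ (∀ s ∈ Set.Icc (-τ) (0:ℝ), y s = v) ∧
    ∀ t ∈ Set.Icc (0:ℝ) T, HasDerivWithinAt y (F t (seg τ y t)) (Set.Icc (0:ℝ) T) t

/-- `F` is weakly nonlinear with constants `K`, `A`: continuous, `‖F(t,0)‖ ≤ A`, and globally
Lipschitz in the second variable with constant `K`. -/
def WeaklyNonlinear {m : ℕ} (τ : ℝ) (F : ℝ → Hist τ m → Fin m → ℝ) (K A : ℝ) : Prop :=
  Continuous (fun p : ℝ × Hist τ m => F p.1 p.2) ∧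
    (∀ t : ℝ, ‖F t 0‖ ≤ A) ∧
    ∀ (t : ℝ) (u v : Hist τ m), ‖F t u - F t v‖ ≤ K * ‖u - v‖

/-- `y` is a continuous solution of the DDE `y'(t) = F(t, y_t)` on `[t₀ - τ, ∞)` with initial
data `y(t₀ + s) = u(s)` for `s ∈ [-τ, 0]`. -/
def IsGlobalSol {m : ℕ} (τ : ℝ) (F : ℝ → Hist τ m → Fin m → ℝ)
    (t₀ : ℝ) (u : Hist τ m) (y : ℝ → Fin m → ℝ) : Prop :=
  Continuous y ∧ (∀ s : Set.Icc (-τ) (0:ℝ), y (t₀ + s.1) = u s) ∧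
    ∀ t ∈ Set.Ici t₀, HasDerivWithinAt y (F t (seg τ y t)) (Set.Ici t₀) t

/-- A special solution of the DDE `y'(t) = F(t, y_t)`: a (continuously differentiable) solution
defined on all of `ℝ` satisfying the growth condition `sup_t e^{-|t|/τ} ‖y(t)‖ < ∞`. -/
def IsSpecialSol {m : ℕ} (τ : ℝ) (F : ℝ → Hist τ m → Fin m → ℝ) (y : ℝ → Fin m → ℝ) : Prop :=
  Continuous y ∧ (∀ t : ℝ, HasDerivAt y (F t (seg τ y t)) t) ∧
    ∃ C : ℝ, ∀ t : ℝ, Real.exp (-|t| / τ) * ‖y t‖ ≤ C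

/-- The defining equation `μ = K e^{μτ}` has a solution in `(0, 1/τ)`. -/
lemma exists_rate_fixedPoint {τ K : ℝ} (hτ : 0 < τ) (hK : 0 < K)
    (hsmall : K * τ * Real.exp 1 < 1) :
    ∃ μ : ℝ, 0 < μ ∧ μ < 1 / τ ∧ μ = K * Real.exp (μ * τ) := by
  have hcont : ContinuousOn (fun μ : ℝ => μ - K * Real.exp (μ * τ)) (Icc 0 (1 / τ)) := by
    fun_prop
  have hend : K * Real.exp (1 / τ * τ) < 1 / τ := by
    rw [one_div_mul_cancel hτ.ne', lt_div_iff₀ hτ]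
    linarith
  obtain ⟨μ, hμ, hzero⟩ := intermediate_value_Ioo (by positivity) hcont
    (show (0 : ℝ) ∈ Ioo _ _ from ⟨by simpa using hK, by simpa using hend⟩)
  exact ⟨μ, hμ.1, hμ.2, by simpa [sub_eq_zero] using hzero⟩

/-- Between its smallest fixed point and `1/τ`, the map `ν ↦ K e^{ντ}` lies below the diagonal. -/
lemma mul_exp_lt_of_fixedPoint_lt {τ K μ ν : ℝ} (hτ : 0 < τ) (hμ : 0 < μ)
    (hfix : μ = K * Real.exp (μ * τ)) (hμν : μ < ν) (hν : ν ≤ 1 / τ) :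
    K * Real.exp (ν * τ) < ν := by
  have hντ : ν * τ ≤ 1 := by rwa [le_div_iff₀ hτ] at hν
  have hsplit : K * Real.exp (ν * τ) = μ * Real.exp ((ν - μ) * τ) := by
    calc K * Real.exp (ν * τ) = K * Real.exp (μ * τ) * Real.exp ((ν - μ) * τ) := by
          rw [mul_assoc, ← Real.exp_add]
          ring_nf
      _ = μ * Real.exp ((ν - μ) * τ) := by rw [← hfix]
  have hx : (ν - μ) * τ ≠ 0 := (mul_pos (sub_pos.2 hμν) hτ).ne'
  have hlt : 1 - (ν - μ) * τ < Real.exp (-((ν - μ) * τ)) := by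
    have := Real.add_one_lt_exp (neg_ne_zero.2 hx)
    linarith
  have hbound : μ < ν * Real.exp (-((ν - μ) * τ)) := by
    nlinarith [mul_nonneg (sub_pos.2 hμν).le (sub_nonneg.2 hντ),
      mul_lt_mul_of_pos_left hlt (hμ.trans hμν)]
  rw [hsplit]
  calc μ * Real.exp ((ν - μ) * τ)
      < ν * Real.exp (-((ν - μ) * τ)) * Real.exp ((ν - μ) * τ) := by gcongr
    _ = ν := by rw [mul_assoc, ← Real.exp_add]; simp

section DelayInequality

variable {E : Type*} [NormedAddCommGroup E]

/-- The function `w` grows backwards in time at exponential rate at most `μ`. -/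
def BackwardRate (w : ℝ → E) (μ : ℝ) : Prop :=
  ∀ t x : ℝ, 0 ≤ x → ‖w (t - x)‖ ≤ ‖w t‖ * Real.exp (μ * x)

/-- The derivative `w'` is bounded at each time by `K` times the supremum of `‖w‖` over the
preceding interval of length `τ`. -/
def DelayBound (τ K : ℝ) (w w' : ℝ → E) : Prop :=
  ∀ t B : ℝ, (∀ x ∈ Icc (0 : ℝ) τ, ‖w (t - x)‖ ≤ B) → ‖w' t‖ ≤ K * B

lemma BackwardRate.norm_deriv_le {τ K μ : ℝ} {w w' : ℝ → E} (hμ : 0 ≤ μ)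
    (hdelay : DelayBound τ K w w') (h : BackwardRate w μ) (t : ℝ) :
    ‖w' t‖ ≤ K * Real.exp (μ * τ) * ‖w t‖ := by
  rw [mul_assoc, mul_comm (Real.exp _)]
  refine hdelay t _ fun x hx => (h t x hx.1).trans ?_
  have := hx.2
  gcongr

lemma isClosed_setOf_backwardRate (w : ℝ → E) : IsClosed {μ | BackwardRate w μ} := by
  simp only [BackwardRate, ofPred_forall]
  exact isClosed_iInter fun t => isClosed_iInter fun x => isClosed_iInter fun _ =>
    isClosed_le continuous_const (by fun_prop)

variable [NormedSpace ℝ E]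

lemma hasDerivAt_comp_time_reversal {w w' : ℝ → E} (hw : ∀ t, HasDerivAt w (w' t) t) (t x : ℝ) :
    HasDerivAt (fun x => w (t - x)) (-w' (t - x)) x := by
  simpa [Function.comp_def] using (hw (t - x)).scomp x ((hasDerivAt_id x).const_sub t)

/-- A backward bound with weight `e^{x/τ}` improves to one with contracted excess. -/
lemma backward_bound_contract {τ K r t : ℝ} {w w' : ℝ → E} (hτ : 0 < τ) (hK : 0 < K)
    (hsmall : K * τ * Real.exp 1 < 1) (hw : ∀ t, HasDerivAt w (w' t) t)
    (hdelay : DelayBound τ K w w') (hr : 0 ≤ r)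
    (hbound : ∀ x, 0 ≤ x → ‖w (t - x)‖ ≤ (‖w t‖ + r) * Real.exp (x / τ)) :
    ∀ x, 0 ≤ x → ‖w (t - x)‖ ≤ (‖w t‖ + K * τ * Real.exp 1 * r) * Real.exp (x / τ) := by
  intro x hx
  set q := K * τ * Real.exp 1 with hq
  have hq0 : 0 < q := by positivity
  have hderiv : ∀ y, HasDerivAt (fun y => ‖w t‖ + q * (‖w t‖ + r) * (Real.exp (y / τ) - 1))
      (q * (‖w t‖ + r) * (Real.exp (y / τ) * (1 / τ))) y := fun y =>
    ((((hasDerivAt_id y).div_const τ).exp.sub_const 1).const_mul _).const_add _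
  have key : ‖w (t - x)‖ ≤ ‖w t‖ + q * (‖w t‖ + r) * (Real.exp (x / τ) - 1) := by
    refine image_norm_le_of_norm_deriv_right_le_deriv_boundary (a := 0) (b := x)
      (f := fun y => w (t - y)) (f' := fun y => -w' (t - y))
      (fun y _ => (hasDerivAt_comp_time_reversal hw t y).continuousAt.continuousWithinAt)
      (fun y _ => (hasDerivAt_comp_time_reversal hw t y).hasDerivWithinAt)
      (by simp) hderiv (fun y hy => ?_) (right_mem_Icc.2 hx)
    have hpast : ‖w' (t - y)‖ ≤ K * ((‖w t‖ + r) * Real.exp ((y + τ) / τ)) := by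
      refine hdelay _ _ fun u hu => ?_
      rw [sub_sub]
      refine (hbound (y + u) (add_nonneg hy.1 hu.1)).trans ?_
      have := hu.2
      gcongr
    rw [norm_neg]
    refine hpast.trans (le_of_eq ?_)
    rw [add_div, div_self hτ.ne', Real.exp_add, hq]
    field_simp
  have hexp : 1 ≤ Real.exp (x / τ) := Real.one_le_exp (by positivity)
  nlinarith [mul_nonneg (mul_nonneg (sub_pos.2 hsmall).le (norm_nonneg (w t)))
    (sub_nonneg.2 hexp), mul_nonneg hq0.le hr]

lemma backwardRate_of_growth {τ K C : ℝ} {w w' : ℝ → E} (hτ : 0 < τ) (hK : 0 < K)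
    (hsmall : K * τ * Real.exp 1 < 1) (hw : ∀ t, HasDerivAt w (w' t) t)
    (hdelay : DelayBound τ K w w') (hC : ∀ t, ‖w t‖ ≤ C * Real.exp (|t| / τ)) :
    BackwardRate w (1 / τ) := by
  intro t x hx
  have hC0 : 0 ≤ C := by simpa using (norm_nonneg _).trans (hC 0)
  have hinit : ∀ x, 0 ≤ x →
      ‖w (t - x)‖ ≤ (‖w t‖ + C * Real.exp (|t| / τ)) * Real.exp (x / τ) := by
    intro x hx
    calc ‖w (t - x)‖ ≤ C * Real.exp (|t - x| / τ) := hC _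
      _ ≤ C * Real.exp ((|t| + x) / τ) := by
        have : |t - x| ≤ |t| + x := by simpa [abs_of_nonneg hx] using abs_sub t x
        gcongr
      _ = C * Real.exp (|t| / τ) * Real.exp (x / τ) := by
        rw [add_div, Real.exp_add, mul_assoc]
      _ ≤ _ := by gcongr; exact le_add_of_nonneg_left (norm_nonneg _)
  have hiter : ∀ n : ℕ, ∀ x, 0 ≤ x → ‖w (t - x)‖ ≤
      (‖w t‖ + (K * τ * Real.exp 1) ^ n * (C * Real.exp (|t| / τ))) * Real.exp (x / τ) := by
    intro n
    induction n with
    | zero => simpa using hinit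
    | succ n ih =>
      rw [pow_succ', mul_assoc]
      exact backward_bound_contract hτ hK hsmall hw hdelay (by positivity) ih
  have hlim := ((((tendsto_pow_atTop_nhds_zero_of_lt_one (by positivity) hsmall).mul_const
    (C * Real.exp (|t| / τ))).const_add ‖w t‖).mul_const (Real.exp (x / τ)))
  have := ge_of_tendsto' hlim fun n => hiter n x hx
  simpa [div_eq_inv_mul] using this

lemma BackwardRate.improve {τ K μ : ℝ} {w w' : ℝ → E} (hμ : 0 ≤ μ)
    (hw : ∀ t, HasDerivAt w (w' t) t) (hdelay : DelayBound τ K w w') (h : BackwardRate w μ) :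
    BackwardRate w (K * Real.exp (μ * τ)) := by
  intro t x hx
  have := norm_le_gronwallBound_of_norm_deriv_right_le (a := 0) (b := x) (δ := ‖w t‖)
    (K := K * Real.exp (μ * τ)) (ε := 0)
    (f := fun y => w (t - y)) (f' := fun y => -w' (t - y))
    (fun y _ => (hasDerivAt_comp_time_reversal hw t y).continuousAt.continuousWithinAt)
    (fun y _ => (hasDerivAt_comp_time_reversal hw t y).hasDerivWithinAt)
    (by simp) (fun y _ => by simpa using h.norm_deriv_le hμ hdelay (t - y)) x
    (right_mem_Icc.2 hx)
  simpa [gronwallBound_ε0] using this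

/-- Exponentially bounded solutions of the delay inequality grow backwards at most at the rate
given by the smallest solution of `μ = K e^{μτ}`. -/
lemma backwardRate_fixedPoint {τ K C μ : ℝ} {w w' : ℝ → E} (hτ : 0 < τ) (hK : 0 < K)
    (hsmall : K * τ * Real.exp 1 < 1) (hw : ∀ t, HasDerivAt w (w' t) t)
    (hdelay : DelayBound τ K w w') (hC : ∀ t, ‖w t‖ ≤ C * Real.exp (|t| / τ))
    (hμ : 0 < μ) (hμτ : μ < 1 / τ) (hfix : μ = K * Real.exp (μ * τ)) :
    BackwardRate w μ := by
  set R : Set ℝ := Icc μ (1 / τ) ∩ {ν | BackwardRate w ν}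
  have hne : R.Nonempty :=
    ⟨1 / τ, right_mem_Icc.2 hμτ.le, backwardRate_of_growth hτ hK hsmall hw hdelay hC⟩
  have hcomp : IsCompact R := isCompact_Icc.inter_right (isClosed_setOf_backwardRate w)
  obtain ⟨ν, ⟨hνI, hν⟩, hmin⟩ := hcomp.exists_isLeast hne
  rcases hνI.1.eq_or_lt with rfl | hlt
  · exact hν
  · have hdecr := mul_exp_lt_of_fixedPoint_lt hτ hμ hfix hlt hνI.2
    have hge : μ ≤ K * Real.exp (ν * τ) := by
      calc μ = K * Real.exp (μ * τ) := hfix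
        _ ≤ K * Real.exp (ν * τ) := by gcongr
    exact absurd (hmin ⟨⟨hge, hdecr.le.trans hνI.2⟩, hν.improve (hμ.le.trans hνI.1) hw hdelay⟩)
      hdecr.not_ge

end DelayInequality

lemma seg_apply {m : ℕ} {τ : ℝ} {y : ℝ → Fin m → ℝ} (hy : Continuous y) (t : ℝ)
    (s : Icc (-τ) (0 : ℝ)) : seg τ y t s = y (t + s.1) := by
  simp [seg, hy]

lemma norm_seg_sub_seg_le {m : ℕ} {τ B : ℝ} (hτ : 0 < τ) {y₁ y₂ : ℝ → Fin m → ℝ}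
    (h₁ : Continuous y₁) (h₂ : Continuous y₂) {t : ℝ}
    (hB : ∀ x ∈ Icc (0 : ℝ) τ, ‖y₁ (t - x) - y₂ (t - x)‖ ≤ B) :
    ‖seg τ y₁ t - seg τ y₂ t‖ ≤ B := by
  have hB0 : 0 ≤ B := (norm_nonneg _).trans (hB 0 (left_mem_Icc.2 hτ.le))
  refine (ContinuousMap.norm_le _ hB0).2 fun s => ?_
  rw [ContinuousMap.sub_apply, seg_apply h₁, seg_apply h₂]
  simpa using hB (-s.1) ⟨neg_nonneg.2 s.2.2, neg_le.1 s.2.1⟩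

lemma continuous_seg {m : ℕ} {τ : ℝ} {y : ℝ → Fin m → ℝ} (hy : Continuous y) :
    Continuous (seg τ y) := by
  refine ContinuousMap.continuous_of_continuous_uncurry _ ?_
  have : Function.uncurry (fun t s => seg τ y t s) =
      fun p : ℝ × Icc (-τ) (0 : ℝ) => y (p.1 + p.2.1) := by
    ext1 p
    exact seg_apply hy p.1 p.2
  rw [this]
  fun_prop

lemma IsSpecialSol.norm_le {m : ℕ} {τ : ℝ} {F : ℝ → Hist τ m → Fin m → ℝ} {y : ℝ → Fin m → ℝ}
    (hy : IsSpecialSol τ F y) : ∃ C : ℝ, ∀ t : ℝ, ‖y t‖ ≤ C * Real.exp (|t| / τ) := by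
  obtain ⟨C, hC⟩ := hy.2.2
  refine ⟨C, fun t => ?_⟩
  have h := mul_le_mul_of_nonneg_right (hC t) (Real.exp_nonneg (|t| / τ))
  rwa [mul_right_comm, ← Real.exp_add, neg_div, neg_add_cancel, Real.exp_zero, one_mul] at h

lemma IsSpecialSol.backwardRate_sub {m : ℕ} {τ K A μ : ℝ} {F : ℝ → Hist τ m → Fin m → ℝ}
    {y₁ y₂ : ℝ → Fin m → ℝ} (hτ : 0 < τ) (hK : 0 < K) (hF : WeaklyNonlinear τ F K A)
    (hsmall : K * τ * Real.exp 1 < 1) (h₁ : IsSpecialSol τ F y₁) (h₂ : IsSpecialSol τ F y₂)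
    (hμ : 0 < μ) (hμτ : μ < 1 / τ) (hfix : μ = K * Real.exp (μ * τ)) :
    BackwardRate (y₁ - y₂) μ := by
  obtain ⟨C₁, hC₁⟩ := h₁.norm_le
  obtain ⟨C₂, hC₂⟩ := h₂.norm_le
  refine backwardRate_fixedPoint (C := C₁ + C₂) hτ hK hsmall
    (fun t => (h₁.2.1 t).sub (h₂.2.1 t)) (fun t B hB => ?_) (fun t => ?_) hμ hμτ hfix
  · exact (hF.2.2 t _ _).trans
      (mul_le_mul_of_nonneg_left (norm_seg_sub_seg_le hτ h₁.1 h₂.1 hB) hK.le)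
  · rw [add_mul]
    exact (norm_sub_le _ _).trans (add_le_add (hC₁ t) (hC₂ t))

lemma IsSpecialSol.norm_seg_sub_le {m : ℕ} {τ K A μ : ℝ} {F : ℝ → Hist τ m → Fin m → ℝ}
    {y₁ y₂ : ℝ → Fin m → ℝ} (hτ : 0 < τ) (hK : 0 < K) (hF : WeaklyNonlinear τ F K A)
    (hsmall : K * τ * Real.exp 1 < 1) (h₁ : IsSpecialSol τ F y₁) (h₂ : IsSpecialSol τ F y₂)
    (hμ : 0 < μ) (hμτ : μ < 1 / τ) (hfix : μ = K * Real.exp (μ * τ)) (t : ℝ) :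
    ‖seg τ y₁ t - seg τ y₂ t‖ ≤ ‖y₁ t - y₂ t‖ * Real.exp (μ * τ) := by
  refine norm_seg_sub_seg_le hτ h₁.1 h₂.1 fun x hx => ?_
  refine (h₁.backwardRate_sub hτ hK hF hsmall h₂ hμ hμτ hfix t x hx.1).trans ?_
  have := hx.2
  simp only [Pi.sub_apply]
  gcongr

/-- The inertial ODE for special solutions: with `S t z` the unique special
solution through `(t,z)` and `F̃(t,z) := F(t, [S t z]_t)`, the vector field `F̃` is continuous
and globally Lipschitz in its second variable with constant `|λ₁| < K·e` (where `λ₁` solves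
`λ = -K e^{-λτ}` in `(-1/τ,0)`), and for every `(t₀,y₀)` the IVP `z' = F̃(t,z)`, `z(t₀) = y₀`
is uniquely solved by the special solution `S t₀ y₀`. -/
theorem special_solutions_solve_ODE
    {m : ℕ} (τ : ℝ) (hτ : 0 < τ) (F : ℝ → Hist τ m → Fin m → ℝ)
    (K A : ℝ) (hK : 0 < K) (hA : 0 ≤ A) (hF : WeaklyNonlinear τ F K A)
    (hsmall : K * τ * Real.exp 1 < 1)
    (S : ℝ → (Fin m → ℝ) → ℝ → Fin m → ℝ)
    (hS : ∀ (t : ℝ) (z : Fin m → ℝ), IsSpecialSol τ F (S t z) ∧ S t z t = z) :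
    ∃ lambda1 : ℝ,
      (-(1/τ) < lambda1 ∧ lambda1 < 0 ∧ lambda1 = -K * Real.exp (-(lambda1 * τ))) ∧
      |lambda1| < K * Real.exp 1 ∧
      Continuous (fun p : ℝ × (Fin m → ℝ) => F p.1 (seg τ (S p.1 p.2) p.1)) ∧
      (∀ (t : ℝ) (z z' : Fin m → ℝ),
        ‖F t (seg τ (S t z) t) - F t (seg τ (S t z') t)‖ ≤ |lambda1| * ‖z - z'‖) ∧
      ∀ (t₀ : ℝ) (y₀ : Fin m → ℝ),
        S t₀ y₀ t₀ = y₀ ∧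
        (∀ t : ℝ, HasDerivAt (S t₀ y₀) (F t (seg τ (S t (S t₀ y₀ t)) t)) t) ∧
        ∀ z : ℝ → Fin m → ℝ,
          (∀ t : ℝ, HasDerivAt z (F t (seg τ (S t (z t)) t)) t) → z t₀ = y₀ →
          ∀ t : ℝ, z t = S t₀ y₀ t := by
  obtain ⟨μ, hμ, hμτ, hfix⟩ := exists_rate_fixedPoint hτ hK hsmall
  have hseg : ∀ {y₁ y₂ : ℝ → Fin m → ℝ}, IsSpecialSol τ F y₁ → IsSpecialSol τ F y₂ → ∀ t : ℝ,
      ‖seg τ y₁ t - seg τ y₂ t‖ ≤ ‖y₁ t - y₂ t‖ * Real.exp (μ * τ) := fun h₁ h₂ t =>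
    h₁.norm_seg_sub_le hτ hK hF hsmall h₂ hμ hμτ hfix t
  have habs : |-μ| = μ := by rw [abs_neg, abs_of_pos hμ]
  have hμτ' : μ * τ < 1 := by rwa [lt_div_iff₀ hτ] at hμτ
  have hlip : ∀ (t : ℝ) (z z' : Fin m → ℝ),
      ‖F t (seg τ (S t z) t) - F t (seg τ (S t z') t)‖ ≤ μ * ‖z - z'‖ := by
    intro t z z'
    have h := hseg (hS t z).1 (hS t z').1 t
    rw [(hS t z).2, (hS t z').2] at h
    calc _ ≤ K * ‖seg τ (S t z) t - seg τ (S t z') t‖ := hF.2.2 t _ _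
      _ ≤ K * (‖z - z'‖ * Real.exp (μ * τ)) := by gcongr
      _ = K * Real.exp (μ * τ) * ‖z - z'‖ := by ring
      _ = μ * ‖z - z'‖ := by rw [← hfix]
  have hcont : Continuous fun p : ℝ × (Fin m → ℝ) => seg τ (S p.1 p.2) p.1 := by
    refine continuous_iff_continuousAt.2 fun p => ?_
    have hy := (hS p.1 p.2).1
    have hmajor : Filter.Tendsto
        (fun q : ℝ × (Fin m → ℝ) => ‖q.2 - S p.1 p.2 q.1‖ * Real.exp (μ * τ))
        (nhds p) (nhds 0) := by
      have hc : Continuous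
          fun q : ℝ × (Fin m → ℝ) => ‖q.2 - S p.1 p.2 q.1‖ * Real.exp (μ * τ) :=
        ((continuous_snd.sub (hy.1.comp continuous_fst)).norm).mul_const _
      simpa [(hS p.1 p.2).2] using hc.tendsto p
    have hdiff := squeeze_zero_norm (fun q : ℝ × (Fin m → ℝ) => by
      simpa [(hS q.1 q.2).2] using hseg (hS q.1 q.2).1 hy q.1) hmajor
    have hbase : Filter.Tendsto (fun q : ℝ × (Fin m → ℝ) => seg τ (S p.1 p.2) q.1)
        (nhds p) (nhds (seg τ (S p.1 p.2) p.1)) :=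
      ((continuous_seg hy.1).comp continuous_fst).tendsto p
    simpa [ContinuousAt] using hdiff.add hbase
  have hsol : ∀ (t₀ : ℝ) (y₀ : Fin m → ℝ) (t : ℝ),
      HasDerivAt (S t₀ y₀) (F t (seg τ (S t (S t₀ y₀ t)) t)) t := by
    intro t₀ y₀ t
    have h := hseg (hS t (S t₀ y₀ t)).1 (hS t₀ y₀).1 t
    rw [(hS t (S t₀ y₀ t)).2, sub_self, norm_zero, zero_mul, norm_le_zero_iff, sub_eq_zero] at h
    rw [h]
    exact (hS t₀ y₀).1.2.1 t
  refine ⟨-μ, ⟨neg_lt_neg hμτ, neg_lt_zero.2 hμ, ?_⟩, ?_, ?_, ?_, fun t₀ y₀ => ⟨(hS t₀ y₀).2,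
    hsol t₀ y₀, fun z hz hz₀ t => ?_⟩⟩
  · rw [neg_mul, neg_mul, neg_neg, ← hfix]
  · rw [habs]
    calc μ = K * Real.exp (μ * τ) := hfix
      _ < K * Real.exp 1 := by gcongr
  · exact hF.1.comp (continuous_fst.prodMk hcont)
  · rwa [habs]
  · have hlipWith : ∀ t, LipschitzOnWith ⟨μ, hμ.le⟩
        (fun z : Fin m → ℝ => F t (seg τ (S t z) t)) univ := fun t =>
      (LipschitzWith.of_dist_le_mul fun z z' => by
        rw [dist_eq_norm, dist_eq_norm]
        exact hlip t z z').lipschitzOnWith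
    exact congrFun (ODE_solution_unique_univ (v := fun t z => F t (seg τ (S t z) t))
      (s := fun _ => univ) (t₀ := t₀) hlipWith
      (fun t => ⟨hz t, mem_univ _⟩) (fun t => ⟨hsol t₀ y₀ t, mem_univ _⟩)
      (hz₀.trans (hS t₀ y₀).2.symm)) t
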